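/- arXiv:2605.19904 — 2 statements merged into one kernel-verified Lean document; each statement's English description precedes it below -/
import Mathlib

section
/- For all integers n ≥ 0, k ≥ 0, and i ≥ 0, one has the closed formula e^k_{n,i} = ∑_{j=0}^{i} (−1)^j · C(n+1, j) · (k+i+1−j)^n, where C(n+1, j) is the binomial coefficient. -/
/-- The extended Eulerian numbers `e^k_{n,i}`: `e^k_{0,0} = 1`, `e^k_{n,i} = 0` whenever
`i < 0` or `i > n`, and otherwise
`e^k_{n,i} = (k+i+1)·e^k_{n-1,i} + (n-k-i)·e^k_{n-1,i-1}`. -/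
def eulk (k : ℕ) : ℕ → ℕ → ℤ
  | 0, 0 => 1
  | 0, _ + 1 => 0
  | n + 1, 0 => ((k : ℤ) + 1) * eulk k n 0
  | n + 1, i + 1 =>
    if i + 1 > n + 1 then 0
    else ((k : ℤ) + (i + 1) + 1) * eulk k n (i + 1) + ((n : ℤ) - k - i) * eulk k n i

theorem eulk_eq_zero_of_lt (k : ℕ) {n i : ℕ} (h : n < i) : eulk k n i = 0 := by
  match n, i, h with
  | 0, _ + 1, _ => simp [eulk]
  | n + 1, i + 1, h => rw [eulk, if_pos h]

/-- The recurrence also holds above the diagonal, where both sides vanish. -/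
theorem eulk_succ_succ (k n i : ℕ) :
    eulk k (n + 1) (i + 1) =
      ((k : ℤ) + (i + 1) + 1) * eulk k n (i + 1) + ((n : ℤ) - k - i) * eulk k n i := by
  by_cases h : i + 1 > n + 1
  · rw [eulk_eq_zero_of_lt k h, eulk_eq_zero_of_lt k (show n < i + 1 by omega),
      eulk_eq_zero_of_lt k (show n < i by omega)]
    simp
  · rw [eulk, if_neg h]

theorem sum_alternating_choose_mul_pow_succ (n m : ℕ) (x : ℤ) :
    ∑ j ∈ Finset.range (m + 1), (-1 : ℤ) ^ j * ((n + 2).choose j) * (x - j) ^ (n + 1) =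
      x * ∑ j ∈ Finset.range (m + 1), (-1 : ℤ) ^ j * ((n + 1).choose j) * (x - j) ^ n +
        (n + 2 - x) *
          ∑ j ∈ Finset.range m, (-1 : ℤ) ^ j * ((n + 1).choose j) * (x - 1 - j) ^ n := by
  rw [Finset.sum_range_succ', Finset.sum_range_succ' _ m, mul_add, Finset.mul_sum, Finset.mul_sum,
    add_right_comm, ← Finset.sum_add_distrib]
  congr 1
  · refine Finset.sum_congr rfl fun j _ => ?_
    have absorb : ((n : ℤ) + 2) * (n + 1).choose j = (n + 2).choose (j + 1) * (j + 1) := by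
      exact_mod_cast Nat.add_one_mul_choose_eq (n + 1) j
    have pascal : ((n + 2).choose (j + 1) : ℤ) = (n + 1).choose j + (n + 1).choose (j + 1) := by
      exact_mod_cast Nat.choose_succ_succ (n + 1) j
    have shift : x - 1 - (j : ℤ) = x - (j + 1) := by ring
    push_cast
    rw [shift, pow_succ (-1 : ℤ) j, pow_succ (x - _) n]
    linear_combination (-1 : ℤ) ^ j * (x - (j + 1)) ^ n * (-absorb - x * pascal)
  · simp [pow_succ, mul_comm]

/-- Closed formula: `e^k_{n,i} = ∑_{j=0}^i (-1)^j C(n+1,j) (k+i+1-j)^n`. -/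
theorem stmt_2 (n k i : ℕ) :
    eulk k n i =
      ∑ j ∈ Finset.range (i + 1), (-1 : ℤ) ^ j * ((n + 1).choose j) * ((k : ℤ) + i + 1 - j) ^ n := by
  induction n generalizing i with
  | zero =>
    cases i with
    | zero => simp [eulk]
    | succ i =>
      rw [Finset.sum_range_succ', Finset.sum_range_succ']
      simp [eulk, Nat.choose_eq_zero_of_lt]
  | succ n ih =>
    cases i with
    | zero => simp [eulk, ih, pow_succ, mul_comm]
    | succ i =>
      rw [eulk_succ_succ, ih, ih, sum_alternating_choose_mul_pow_succ]
      have shift : (k : ℤ) + (i + 1 : ℕ) + 1 - 1 = k + i + 1 := by push_cast; ring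
      rw [shift]
      push_cast
      ring
end

section
/- Let k ≥ 1 and let S = H^k T (a run of k heads followed by one tails). Then E(Y^0) = 1, and for every integer n ≥ 1, E(Y^n) = ∑_{j=1}^{n−1} C(n, j) · E(Y^j) · ∑_{i=1}^{k} (1−p) · i^{n−j} / p^{k−i+1} + ∑_{i=1}^{∞} (1−p) · i^n / p^{k−i+1}, where the infinite series ∑_{i=1}^{∞} (1−p) · i^n · p^{i−1−k} converges. -/
/-- The probability of a given sequence of coin flips, where `true` stands for heads
(probability `p`) and `false` for tails (probability `1 - p`). -/
def coinP (p : ℝ) (w : List Bool) : ℝ := (w.map fun b => if b then p else 1 - p).prod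

/-- The number of occurrences of `S` as a factor (consecutive substring) of `w`. -/
def numOccs (S w : List Bool) : ℕ :=
  ((Finset.range (w.length + 1)).filter fun i => (w.drop i).take S.length = S).card

/-- `coinZ S` is the set of finite binary strings in which `S` occurs exactly once as a
factor, namely as a suffix. -/
def coinZ (S : List Bool) : Set (List Bool) := {w | S <:+ w ∧ numOccs S w = 1}

/-- The `n`-th moment `E(Y^n) = ∑_{w ∈ Z(S)} |w|^n P(w)` of the number of coin flips
needed to produce `S`. -/
noncomputable def coinE (p : ℝ) (S : List Bool) (n : ℕ) : ℝ :=
  ∑' w : coinZ S, (w.1.length : ℝ) ^ n * coinP p w.1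

theorem numOccs_nil {S : List Bool} (hS : S ≠ []) : numOccs S [] = 0 := by
  simp [numOccs, hS.symm]

theorem numOccs_cons {S : List Bool} (b : Bool) (w : List Bool) :
    numOccs S (b :: w) = (if S <+: b :: w then 1 else 0) + numOccs S w := by
  unfold numOccs
  simp only [Finset.card_filter]
  rw [List.length_cons, Finset.sum_range_succ', add_comm]
  simp only [List.drop_succ_cons, List.drop_zero, List.prefix_iff_eq_take, eq_comm]

theorem numOccs_pos_of_suffix {S w : List Bool} (h : S <:+ w) : 1 ≤ numOccs S w := by
  obtain ⟨u, rfl⟩ := h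
  unfold numOccs
  refine Finset.card_pos.mpr ⟨u.length, ?_⟩
  simp

/-- The word `H^m T w`. -/
def headRun (m : ℕ) (w : List Bool) : List Bool := List.replicate m true ++ false :: w

theorem headRun_zero (w : List Bool) : headRun 0 w = false :: w := rfl

theorem headRun_succ (m : ℕ) (w : List Bool) : headRun (m + 1) w = true :: headRun m w := rfl

theorem headRun_injective {m m' : ℕ} {w w' : List Bool} (h : headRun m w = headRun m' w') :
    m = m' ∧ w = w' := by
  induction m generalizing m' with
  | zero => cases m' <;> simp_all [headRun_zero, headRun_succ]
  | succ m ih =>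
    cases m' with
    | zero => simp [headRun_zero, headRun_succ] at h
    | succ m' =>
      simp only [headRun_succ, List.cons.injEq, true_and] at h
      simpa using ih h

theorem exists_eq_headRun {w : List Bool} (h : false ∈ w) : ∃ m v, w = headRun m v := by
  induction w with
  | nil => simp at h
  | cons b w ih =>
    cases b with
    | false => exact ⟨0, w, rfl⟩
    | true =>
      obtain ⟨m, v, rfl⟩ := ih (by simpa using h)
      exact ⟨m + 1, v, rfl⟩

theorem length_headRun (m : ℕ) (w : List Bool) : (headRun m w).length = w.length + m + 1 := by
  simp [headRun]; omega

theorem coinP_headRun (p : ℝ) (m : ℕ) (w : List Bool) :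
    coinP p (headRun m w) = (1 - p) * p ^ m * coinP p w := by
  simp [headRun, coinP]; ring

theorem coinP_nonneg {p : ℝ} (hp : 0 ≤ p) (hp1 : p ≤ 1) (w : List Bool) : 0 ≤ coinP p w := by
  refine List.prod_nonneg fun x hx => ?_
  obtain ⟨b, -, rfl⟩ := List.mem_map.mp hx
  cases b <;> simp [hp, hp1]

theorem headRun_nil_prefix_headRun {k m : ℕ} {w : List Bool} :
    headRun k [] <+: headRun m w ↔ k = m := by
  constructor
  · rintro ⟨v, hv⟩
    exact (headRun_injective (w := v) (by simpa [headRun] using hv)).1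
  · rintro rfl
    exact ⟨w, by simp [headRun]⟩

theorem numOccs_headRun {k : ℕ} (hk : 1 ≤ k) (m : ℕ) (w : List Bool) :
    numOccs (headRun k []) (headRun m w) =
      (if k ≤ m then 1 else 0) + numOccs (headRun k []) w := by
  induction m with
  | zero =>
    rw [headRun_zero, numOccs_cons, ← headRun_zero, if_neg, if_neg (by omega)]
    rw [headRun_nil_prefix_headRun]; omega
  | succ m ih =>
    rw [headRun_succ, numOccs_cons, ← headRun_succ, ih]
    simp only [headRun_nil_prefix_headRun]
    split_ifs <;> omega

theorem headRun_nil_suffix_headRun {k m : ℕ} {w : List Bool} :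
    headRun k [] <:+ headRun m w ↔ (w = [] ∧ k ≤ m) ∨ headRun k [] <:+ w := by
  have hw : false :: w <:+ headRun m w := List.suffix_append _ _
  constructor
  · intro h
    rcases le_or_gt (headRun k []).length w.length with hl | hl
    · exact .inr (List.suffix_of_suffix_length_le h ((List.suffix_cons _ _).trans hw) hl)
    · left
      have hlen := h.length_le
      obtain ⟨t, ht⟩ := List.suffix_of_suffix_length_le hw h (by simpa using hl)
      rcases List.eq_nil_or_concat w with rfl | ⟨v, b, rfl⟩
      · simp only [length_headRun, List.length_nil] at hlen
        exact ⟨rfl, by omega⟩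
      · have h' : (t ++ false :: v) ++ [b] = List.replicate k true ++ [false] := by
          simpa [headRun] using ht
        have h'' := (List.append_inj' h' rfl).1
        have : false ∈ List.replicate k true := h'' ▸ by simp
        simp at this
  · rintro (⟨rfl, h⟩ | h)
    · refine ⟨List.replicate (m - k) true, ?_⟩
      rw [headRun, headRun, ← List.append_assoc, List.replicate_append_replicate,
        Nat.sub_add_cancel h]
    · exact h.trans ((List.suffix_cons _ _).trans hw)

theorem headRun_mem_coinZ_iff_of_lt {k m : ℕ} (hm : m < k) {w : List Bool} :
    headRun m w ∈ coinZ (headRun k []) ↔ w ∈ coinZ (headRun k []) := by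
  simp [coinZ, headRun_nil_suffix_headRun, numOccs_headRun (by omega : 1 ≤ k), hm.not_ge]

theorem headRun_mem_coinZ_iff_of_le {k m : ℕ} (hk : 1 ≤ k) (hm : k ≤ m) {w : List Bool} :
    headRun m w ∈ coinZ (headRun k []) ↔ w = [] := by
  simp only [coinZ, Set.mem_ofPred_eq, headRun_nil_suffix_headRun, numOccs_headRun hk, hm]
  constructor
  · rintro ⟨⟨h, -⟩ | h, h1⟩
    · exact h
    · have := numOccs_pos_of_suffix h
      simp at h1
      omega
  · rintro rfl
    simp [numOccs_nil (S := headRun k []) (by simp [headRun])]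

/-- A word in which `H^k T` occurs only as a suffix either starts with a run of `i < k` heads and
one tails, followed by another such word, or is `H^m T` with `m ≥ k`. -/
noncomputable def coinZEquiv {k : ℕ} (hk : 1 ≤ k) :
    (Fin k × coinZ (headRun k [])) ⊕ ℕ ≃ coinZ (headRun k []) :=
  Equiv.ofBijective
    (Sum.elim
      (fun x => ⟨headRun x.1 x.2.1, (headRun_mem_coinZ_iff_of_lt x.1.2).mpr x.2.2⟩)
      (fun j => ⟨headRun (k + j) [], (headRun_mem_coinZ_iff_of_le hk (by omega)).mpr rfl⟩))
    (by
      constructor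
      · rintro (⟨i, w⟩ | j) (⟨i', w'⟩ | j') h <;>
          simp only [Sum.elim_inl, Sum.elim_inr, Subtype.mk.injEq] at h <;>
          have h' := headRun_injective h
        · rw [Fin.ext h'.1, Subtype.ext h'.2]
        · have := i.2; omega
        · have := i'.2; omega
        · rw [show j = j' by omega]
      · rintro ⟨w, hw⟩
        obtain ⟨m, v, rfl⟩ := exists_eq_headRun (hw.1.mem (by simp [headRun] : false ∈ _))
        rcases lt_or_ge m k with hm | hm
        · exact ⟨.inl (⟨m, hm⟩, ⟨v, (headRun_mem_coinZ_iff_of_lt hm).mp hw⟩), rfl⟩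
        · obtain rfl := (headRun_mem_coinZ_iff_of_le hk hm).mp hw
          refine ⟨.inr (m - k), Subtype.ext ?_⟩
          simp [Nat.add_sub_cancel' hm])

/-- First-step decomposition of sums over the words in which `H^k T` occurs only as a suffix. -/
theorem tsum_coinZ_headRun (p : ℝ) {k : ℕ} (hk : 1 ≤ k) (g : ℕ → ℝ)
    (hg : Summable fun w : coinZ (headRun k []) => g w.1.length * coinP p w.1) :
    ∑' w : coinZ (headRun k []), g w.1.length * coinP p w.1 =
      ∑ i ∈ Finset.range k, (1 - p) * p ^ i *
          ∑' w : coinZ (headRun k []), g (w.1.length + i + 1) * coinP p w.1 +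
        ∑' j : ℕ, (1 - p) * p ^ (k + j) * g (k + j + 1) := by
  have he := (coinZEquiv hk).summable_iff.mpr hg
  have hl := he.comp_injective Sum.inl_injective
  have hr := he.comp_injective Sum.inr_injective
  refine ((coinZEquiv hk).tsum_eq _).symm.trans ((Summable.tsum_sum hl hr).trans ?_)
  refine (congrArg₂ _ ((Summable.tsum_prod hl).trans (tsum_fintype _)) rfl).trans ?_
  rw [Finset.sum_range]
  congr 1
  · refine Finset.sum_congr rfl fun i _ => ?_
    rw [← tsum_mul_left]
    refine tsum_congr fun w => ?_
    change g (headRun i w).length * coinP p (headRun i w) = _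
    rw [length_headRun, coinP_headRun]
    ring
  · refine tsum_congr fun j => ?_
    change g (headRun (k + j) []).length * coinP p (headRun (k + j) []) = _
    rw [length_headRun, coinP_headRun, List.length_nil, zero_add]
    simp [coinP, mul_comm]

theorem exists_one_lt_sum_lt_one {p : ℝ} (hp : 0 < p) (hp1 : p < 1) (k : ℕ) :
    ∃ x : ℝ, 1 < x ∧ p * x < 1 ∧ ∑ i ∈ Finset.range k, (1 - p) * p ^ i * x ^ (i + 1) < 1 := by
  have h1 : ∀ᶠ x in nhds (1 : ℝ), p * x < 1 :=
    (by fun_prop : Continuous fun x : ℝ => p * x).continuousAt.eventually_lt_const (by simpa)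
  have h2 : ∀ᶠ x in nhds (1 : ℝ), ∑ i ∈ Finset.range k, (1 - p) * p ^ i * x ^ (i + 1) < 1 := by
    refine (by fun_prop : Continuous fun x : ℝ =>
      ∑ i ∈ Finset.range k, (1 - p) * p ^ i * x ^ (i + 1)).continuousAt.eventually_lt_const ?_
    simp only [one_pow, mul_one]
    rw [← Finset.mul_sum, mul_neg_geom_sum]
    linarith [pow_pos hp k]
  have h := (h1.and h2).filter_mono (nhdsWithin_le_nhds (s := Set.Ioi 1))
  obtain ⟨x, ⟨hx1, hx2⟩, hx⟩ := (h.and self_mem_nhdsWithin).exists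
  exact ⟨x, hx, hx1, hx2⟩

theorem summable_truncated (p : ℝ) (S : List Bool) (g : ℕ → ℝ) (M : ℕ) :
    Summable fun w : coinZ S => (if w.1.length < M then g w.1.length else 0) * coinP p w.1 := by
  refine summable_of_hasFiniteSupport (((List.finite_length_lt Bool M).preimage
    Subtype.val_injective.injOn).subset fun w hw => ?_)
  by_contra h
  have h' : ¬ w.1.length < M := h
  simp [h'] at hw

theorem exists_summable_pow_length {p : ℝ} (hp : 0 < p) (hp1 : p < 1) {k : ℕ} (hk : 1 ≤ k) :
    ∃ x : ℝ, 1 < x ∧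
      Summable fun w : coinZ (headRun k []) => x ^ w.1.length * coinP p w.1 := by
  obtain ⟨x, hx, hpx, hθ⟩ := exists_one_lt_sum_lt_one hp hp1 k
  refine ⟨x, hx, ?_⟩
  have hx0 : 0 < x := by linarith
  have hq : 0 < 1 - p := by linarith
  have hP (w : List Bool) : 0 ≤ coinP p w := coinP_nonneg hp.le hp1.le w
  set θ := ∑ i ∈ Finset.range k, (1 - p) * p ^ i * x ^ (i + 1) with hθdef
  have hc : Summable fun j : ℕ => (1 - p) * p ^ (k + j) * x ^ (k + j + 1) := by
    refine ((summable_geometric_of_lt_one (by positivity) hpx).mul_left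
      ((1 - p) * p ^ k * x ^ (k + 1))).congr fun j => ?_
    rw [mul_pow]; ring
  set c := ∑' j : ℕ, (1 - p) * p ^ (k + j) * x ^ (k + j + 1) with hcdef
  have hc0 : 0 ≤ c := tsum_nonneg fun j => by positivity
  have hC0 : 0 ≤ c / (1 - θ) := div_nonneg hc0 (by linarith)
  have hC : θ * (c / (1 - θ)) + c = c / (1 - θ) := by
    have : 1 - θ ≠ 0 := by linarith
    field_simp
    ring
  have bound (M : ℕ) : ∑' w : coinZ (headRun k []),
      (if w.1.length < M then x ^ w.1.length else 0) * coinP p w.1 ≤ c / (1 - θ) := by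
    induction M with
    | zero => simpa using hC0
    | succ M ih =>
      rw [tsum_coinZ_headRun p hk (fun N => if N < M + 1 then x ^ N else 0)
        (summable_truncated p _ (fun N => x ^ N) (M + 1)), ← hC]
      refine add_le_add ?_ ?_
      · rw [hθdef, Finset.sum_mul]
        refine Finset.sum_le_sum fun i _ => ?_
        rw [mul_assoc _ (x ^ (i + 1))]
        refine mul_le_mul_of_nonneg_left ?_ (by positivity)
        refine le_trans ?_ (mul_le_mul_of_nonneg_left ih (by positivity))
        rw [← tsum_mul_left]
        have hs := (summable_truncated p (headRun k []) (fun N => x ^ N) M).mul_left (x ^ (i + 1))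
        have hle (w : coinZ (headRun k [])) :
            (if w.1.length + i + 1 < M + 1 then x ^ (w.1.length + i + 1) else 0) * coinP p w.1 ≤
              x ^ (i + 1) * ((if w.1.length < M then x ^ w.1.length else 0) * coinP p w.1) := by
          rw [← mul_assoc]
          refine mul_le_mul_of_nonneg_right ?_ (hP _)
          split_ifs
          · exact (by ring : _ = _).le
          · omega
          · positivity
          · simp
        refine Summable.tsum_le_tsum hle (hs.of_nonneg_of_le (fun w => ?_) hle) hs
        refine mul_nonneg ?_ (hP _)
        split_ifs <;> positivity
      · have hle (j : ℕ) : (1 - p) * p ^ (k + j) *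
            (if k + j + 1 < M + 1 then x ^ (k + j + 1) else 0) ≤
              (1 - p) * p ^ (k + j) * x ^ (k + j + 1) := by
          refine mul_le_mul_of_nonneg_left ?_ (by positivity)
          split_ifs
          · rfl
          · positivity
        refine Summable.tsum_le_tsum hle (hc.of_nonneg_of_le (fun j => ?_) hle) hc
        refine mul_nonneg (by positivity) ?_
        split_ifs <;> positivity
  refine summable_of_sum_le (c := c / (1 - θ))
    (fun w => mul_nonneg (by positivity) (hP _)) fun u => ?_
  have hM : ∀ w ∈ u, w.1.length < u.sup (fun w => w.1.length) + 1 := fun w hw =>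
    Nat.lt_succ_of_le (Finset.le_sup (f := fun w : coinZ (headRun k []) => w.1.length) hw)
  refine le_trans ?_ (bound (u.sup (fun w => w.1.length) + 1))
  refine le_trans (Finset.sum_le_sum fun w hw => ?_)
    ((summable_truncated p _ (fun N => x ^ N) _).sum_le_tsum u fun w _ => ?_)
  · rw [if_pos (hM w hw)]
  · refine mul_nonneg ?_ (hP _)
    split_ifs <;> positivity

theorem summable_length_pow {p : ℝ} (hp : 0 < p) (hp1 : p < 1) {k : ℕ} (hk : 1 ≤ k) (n : ℕ) :
    Summable fun w : coinZ (headRun k []) => (w.1.length : ℝ) ^ n * coinP p w.1 := by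
  obtain ⟨x, hx, hs⟩ := exists_summable_pow_length hp hp1 hk
  obtain ⟨B, hB⟩ := (tendsto_pow_const_div_const_pow_of_one_lt n hx).bddAbove_range
  refine (hs.mul_left B).of_nonneg_of_le
    (fun w => mul_nonneg (by positivity) (coinP_nonneg hp.le hp1.le _)) fun w => ?_
  rw [← mul_assoc]
  refine mul_le_mul_of_nonneg_right ?_ (coinP_nonneg hp.le hp1.le _)
  exact (div_le_iff₀ (by positivity)).mp (hB ⟨w.1.length, rfl⟩)

/-- The moments satisfy the recursion obtained by conditioning on the first run of heads. -/
theorem coinE_headRun {p : ℝ} (hp : 0 < p) (hp1 : p < 1) {k : ℕ} (hk : 1 ≤ k) (n : ℕ) :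
    coinE p (headRun k []) n =
      ∑ i ∈ Finset.range k, (1 - p) * p ^ i *
          ∑ j ∈ Finset.range (n + 1),
            (n.choose j : ℝ) * coinE p (headRun k []) j * ((i : ℝ) + 1) ^ (n - j) +
        ∑' j : ℕ, (1 - p) * p ^ (k + j) * ((k + j + 1 : ℕ) : ℝ) ^ n := by
  have h := tsum_coinZ_headRun p hk (fun N => (N : ℝ) ^ n) (summable_length_pow hp hp1 hk n)
  refine h.trans ?_
  congr 1
  refine Finset.sum_congr rfl fun i _ => ?_
  congr 1
  have hexp (w : coinZ (headRun k [])) :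
      ((w.1.length + i + 1 : ℕ) : ℝ) ^ n * coinP p w.1 =
        ∑ j ∈ Finset.range (n + 1), (n.choose j : ℝ) * ((i : ℝ) + 1) ^ (n - j) *
          ((w.1.length : ℝ) ^ j * coinP p w.1) := by
    rw [add_assoc, Nat.cast_add, add_pow, Finset.sum_mul]
    refine Finset.sum_congr rfl fun j _ => ?_
    push_cast
    ring
  rw [tsum_congr hexp,
    Summable.tsum_finsetSum fun j _ => (summable_length_pow hp hp1 hk j).mul_left _]
  refine Finset.sum_congr rfl fun j _ => ?_
  rw [tsum_mul_left, coinE]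
  ring

theorem coinE_headRun_zero {p : ℝ} (hp : 0 < p) (hp1 : p < 1) {k : ℕ} (hk : 1 ≤ k) :
    coinE p (headRun k []) 0 = 1 := by
  have h := coinE_headRun hp hp1 hk 0
  have ht : ∑' j : ℕ, (1 - p) * p ^ (k + j) = p ^ k := by
    simp only [pow_add, ← mul_assoc]
    rw [tsum_mul_left, tsum_geometric_of_lt_one hp.le hp1]
    have : 1 - p ≠ 0 := by linarith
    field_simp
  simp only [zero_add, Finset.sum_range_one, Nat.choose_self, Nat.cast_one, one_mul, Nat.sub_self,
    pow_zero, mul_one, ht] at h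
  rw [← Finset.sum_mul, ← Finset.mul_sum, mul_neg_geom_sum] at h
  exact mul_left_cancel₀ (pow_pos hp k).ne' (by linarith)

theorem summable_geometric_mul_pow {p : ℝ} (hp : 0 < p) (hp1 : p < 1) (n : ℕ) :
    Summable fun i : ℕ => (1 - p) * p ^ i * ((i : ℝ) + 1) ^ n := by
  have h := (summable_nat_add_iff 1).mpr (summable_pow_mul_geometric_of_norm_lt_one (R := ℝ) n
    (r := p) (by rwa [Real.norm_of_nonneg hp.le]))
  refine (h.mul_left ((1 - p) / p)).congr fun i => ?_
  push_cast
  field_simp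
  ring

theorem coinE_headRun_of_pos {p : ℝ} (hp : 0 < p) (hp1 : p < 1) {k : ℕ} (hk : 1 ≤ k) {n : ℕ}
    (hn : 1 ≤ n) :
    p ^ k * coinE p (headRun k []) n =
      ∑ j ∈ Finset.Icc 1 (n - 1), (n.choose j : ℝ) * coinE p (headRun k []) j *
          ∑ i ∈ Finset.range k, (1 - p) * p ^ i * ((i : ℝ) + 1) ^ (n - j) +
        ∑' i : ℕ, (1 - p) * p ^ i * ((i : ℝ) + 1) ^ n := by
  obtain ⟨m, rfl⟩ := Nat.exists_eq_add_of_le' hn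
  have h := coinE_headRun hp hp1 hk (m + 1)
  simp only [Finset.mul_sum] at h
  rw [Finset.sum_comm, Finset.sum_range_succ, Finset.sum_range_succ',
    coinE_headRun_zero hp hp1 hk] at h
  have htop : ∑ i ∈ Finset.range k, (1 - p) * p ^ i * (((m + 1).choose (m + 1) : ℝ) *
      coinE p (headRun k []) (m + 1) * ((i : ℝ) + 1) ^ (m + 1 - (m + 1))) =
        (1 - p ^ k) * coinE p (headRun k []) (m + 1) := by
    simp only [Nat.choose_self, Nat.cast_one, one_mul, Nat.sub_self, pow_zero, mul_one]
    rw [← Finset.sum_mul, ← Finset.mul_sum, mul_neg_geom_sum]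
  have hbot := (summable_geometric_mul_pow hp hp1 (m + 1)).sum_add_tsum_nat_add k
  have htail : ∑' j : ℕ, (1 - p) * p ^ (k + j) * ((k + j + 1 : ℕ) : ℝ) ^ (m + 1) =
      ∑' j : ℕ, (1 - p) * p ^ (j + k) * (((j + k : ℕ) : ℝ) + 1) ^ (m + 1) :=
    tsum_congr fun j => by rw [add_comm k j]; push_cast; rfl
  have hmid : ∑ j ∈ Finset.Icc 1 (m + 1 - 1), ((m + 1).choose j : ℝ) * coinE p (headRun k []) j *
      ∑ i ∈ Finset.range k, (1 - p) * p ^ i * ((i : ℝ) + 1) ^ (m + 1 - j) =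
        ∑ j ∈ Finset.range m, ∑ i ∈ Finset.range k, (1 - p) * p ^ i *
          (((m + 1).choose (j + 1) : ℝ) * coinE p (headRun k []) (j + 1) *
            ((i : ℝ) + 1) ^ (m + 1 - (j + 1))) := by
    rw [Nat.add_sub_cancel, Finset.range_eq_Ico m, Finset.sum_Ico_add'
      (fun j => ∑ i ∈ Finset.range k, (1 - p) * p ^ i * (((m + 1).choose j : ℝ) *
        coinE p (headRun k []) j * ((i : ℝ) + 1) ^ (m + 1 - j)))]
    refine Finset.sum_congr (by rw [zero_add]; rfl) fun j _ => ?_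
    rw [Finset.mul_sum]
    exact Finset.sum_congr rfl fun i _ => by ring
  simp only [Nat.choose_zero_right, Nat.cast_one, one_mul, Nat.sub_zero] at h
  rw [htop, htail] at h
  rw [hmid, ← hbot]
  linarith

/-- Recursive formula for the moments when `S = H^k T`. -/
theorem stmt_8 (p : ℝ) (hp : 0 < p) (hp1 : p < 1) (k : ℕ) (hk : 1 ≤ k) :
    coinE p (List.replicate k true ++ [false]) 0 = 1 ∧
      ∀ n : ℕ, 1 ≤ n →
        Summable (fun i : ℕ => (1 - p) * (i : ℝ) ^ n / p ^ ((k : ℤ) - i + 1)) ∧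
          coinE p (List.replicate k true ++ [false]) n =
            (∑ j ∈ Finset.Icc 1 (n - 1),
              (n.choose j : ℝ) * coinE p (List.replicate k true ++ [false]) j *
                ∑ i ∈ Finset.Icc 1 k, (1 - p) * (i : ℝ) ^ (n - j) / p ^ (k - i + 1)) +
              ∑' i : ℕ, (1 - p) * (i : ℝ) ^ n / p ^ ((k : ℤ) - i + 1) := by
  change coinE p (headRun k []) 0 = 1 ∧ ∀ n : ℕ, 1 ≤ n → _ ∧ coinE p (headRun k []) n =
    (∑ j ∈ Finset.Icc 1 (n - 1), (n.choose j : ℝ) * coinE p (headRun k []) j * _) + _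
  refine ⟨coinE_headRun_zero hp hp1 hk, fun n hn => ?_⟩
  have hterm (i : ℕ) : (1 - p) * ((i + 1 : ℕ) : ℝ) ^ n / p ^ ((k : ℤ) - (i + 1 : ℕ) + 1) =
      (p ^ k)⁻¹ * ((1 - p) * p ^ i * ((i : ℝ) + 1) ^ n) := by
    have : (k : ℤ) - (i + 1 : ℕ) + 1 = k - i := by push_cast; ring
    rw [this, zpow_sub₀ hp.ne', zpow_natCast, zpow_natCast]
    push_cast
    field_simp
  have hs : Summable fun i : ℕ => (1 - p) * (i : ℝ) ^ n / p ^ ((k : ℤ) - i + 1) := by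
    rw [← summable_nat_add_iff 1]
    exact ((summable_geometric_mul_pow hp hp1 n).mul_left (p ^ k)⁻¹).congr fun i => (hterm i).symm
  refine ⟨hs, ?_⟩
  have hfin (j : ℕ) : ∑ i ∈ Finset.Icc 1 k, (1 - p) * (i : ℝ) ^ (n - j) / p ^ (k - i + 1) =
      (p ^ k)⁻¹ * ∑ i ∈ Finset.range k, (1 - p) * p ^ i * ((i : ℝ) + 1) ^ (n - j) := by
    rw [Finset.mul_sum, Finset.range_eq_Ico]
    have : Finset.Icc 1 k = Finset.Ico (0 + 1) (k + 1) := by rw [zero_add]; rfl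
    rw [this, ← Finset.sum_Ico_add' (fun i : ℕ => (1 - p) * (i : ℝ) ^ (n - j) / p ^ (k - i + 1))]
    refine Finset.sum_congr rfl fun i hi => ?_
    have hik : i < k := (Finset.mem_Ico.mp hi).2
    have hpow : p ^ k = p ^ i * p ^ (k - (i + 1) + 1) := by rw [← pow_add]; congr 1; omega
    rw [hpow]
    push_cast
    field_simp
  rw [hs.tsum_eq_zero_add, tsum_congr hterm, tsum_mul_left]
  simp only [hfin, Nat.cast_zero, zero_pow (by omega : n ≠ 0), mul_zero, zero_div, zero_add]
  rw [← mul_right_inj' (pow_pos hp k).ne', coinE_headRun_of_pos hp hp1 hk hn, mul_add,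
    mul_inv_cancel_left₀ (pow_pos hp k).ne', Finset.mul_sum]
  congr 1
  refine Finset.sum_congr rfl fun j _ => ?_
  field_simp
end
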